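/- arXiv:2505.19648 — 2 statements merged into one kernel-verified Lean document; each statement's English description precedes it below -/
import Mathlib

section
/- Let Γ be an SNF-with-equality sentence over L. For all configurations n and n′ such that for every 1-type τ: n′(τ) ≥ n(τ) whenever n(τ) > 1, and n′(τ) = n(τ) whenever n(τ) ≤ 1, the following holds: if n is satisfiable with respect to Γ, then n′ is satisfiable with respect to Γ. -/
/-- An `L`-structure (for a language `L` with unary symbols `U` and binary
symbols `B`) on domain `D`. -/
structure Struc (U B : Type) (D : Type) where
  unary : U → D → Prop
  binary : B → D → D → Prop

/-- Quantifier-free formulas over relational atoms and equality atoms in the two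
variables `x` (encoded as `false`) and `y` (encoded as `true`), built using
`¬`, `∧`, `∨`. -/
inductive QFE (U B : Type) where
  | uatom : U → Bool → QFE U B
  | batom : B → Bool → Bool → QFE U B
  | eq : Bool → Bool → QFE U B
  | not : QFE U B → QFE U B
  | and : QFE U B → QFE U B → QFE U B
  | or : QFE U B → QFE U B → QFE U B

/-- Evaluation of a quantifier-free formula in a structure with `x ↦ a`, `y ↦ b`. -/
def QFE.Eval {U B D : Type} (S : Struc U B D) (a b : D) : QFE U B → Prop
  | .uatom P v => S.unary P (if v then b else a)
  | .batom R v w => S.binary R (if v then b else a) (if w then b else a)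
  | .eq v w => (if v then b else a) = (if w then b else a)
  | .not f => ¬ f.Eval S a b
  | .and f g => f.Eval S a b ∧ g.Eval S a b
  | .or f g => f.Eval S a b ∨ g.Eval S a b

/-- An SNF-with-equality sentence `(∀x∀y φ(x,y)) ∧ ⋀_{k=1}^m (∀x∃y β_k(x,y))`,
where `φ` may contain equality atoms. -/
structure SNFE (U B : Type) where
  m : ℕ
  phi : QFE U B
  beta : Fin m → B

/-- Satisfaction of an SNF-with-equality sentence in a structure. -/
def SNFE.Sat {U B D : Type} (Γ : SNFE U B) (S : Struc U B D) : Prop :=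
  (∀ a b, Γ.phi.Eval S a b) ∧ ∀ k a, ∃ b, S.binary (Γ.beta k) a b

/-- A 1-type: a truth-value assignment to each atomic formula `P(x)`, `R(x,x)`. -/
structure OneType (U B : Type) where
  unary : U → Prop
  binary : B → Prop

/-- An element `e` realizes a 1-type `τ` in a structure `S`. -/
def Realizes1 {U B D : Type} (S : Struc U B D) (e : D) (τ : OneType U B) : Prop :=
  (∀ P, S.unary P e ↔ τ.unary P) ∧ (∀ R, S.binary R e e ↔ τ.binary R)

/-- The configuration of a structure: the number of elements realizing each 1-type. -/
noncomputable def config {U B D : Type} (S : Struc U B D) : OneType U B → ℕ :=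
  fun τ => Nat.card {e : D // Realizes1 S e τ}

/-- A configuration `n` is satisfiable w.r.t. `Γ`: some finite model of `Γ` has
configuration `n`. -/
def SatConfig {U B : Type} (Γ : SNFE U B) (n : OneType U B → ℕ) : Prop :=
  ∃ (D : Type) (_ : Fintype D) (M : Struc U B D), Γ.Sat M ∧ config M = n

/-- The 1-type of an element. -/
def Struc.oneType {U B D : Type} (S : Struc U B D) (e : D) : OneType U B where
  unary P := S.unary P e
  binary R := S.binary R e e

theorem realizes1_iff_oneType_eq {U B D : Type} (S : Struc U B D) (e : D) (τ : OneType U B) :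
    Realizes1 S e τ ↔ S.oneType e = τ := by
  constructor
  · rintro ⟨hu, hb⟩
    cases τ
    simp only [Struc.oneType, OneType.mk.injEq]
    exact ⟨funext fun P => propext (hu P), funext fun R => propext (hb R)⟩
  · rintro rfl
    exact ⟨fun _ => Iff.rfl, fun _ => Iff.rfl⟩

instance OneType.finite {U B : Type} [Finite U] [Finite B] : Finite (OneType U B) :=
  Finite.of_injective (fun τ : OneType U B => (τ.unary, τ.binary)) fun σ τ h => by
    cases σ
    cases τ
    simpa using h

/-- Pairs with the same atomic diagram satisfy the same quantifier-free formulas. -/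
theorem QFE.eval_congr {U B D E : Type} {S : Struc U B D} {T : Struc U B E} {a b : D} {c d : E}
    (hac : S.oneType a = T.oneType c) (hbd : S.oneType b = T.oneType d) (heq : a = b ↔ c = d)
    (hab : ∀ R, S.binary R a b ↔ T.binary R c d) (hba : ∀ R, S.binary R b a ↔ T.binary R d c)
    (f : QFE U B) : f.Eval S a b ↔ f.Eval T c d := by
  simp only [Struc.oneType, OneType.mk.injEq, funext_iff, eq_iff_iff] at hac hbd
  induction f with
  | uatom P v => cases v <;> simp [QFE.Eval, hac.1, hbd.1]
  | batom R v w => cases v <;> cases w <;> simp [QFE.Eval, hac.2, hbd.2, hab, hba]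
  | eq v w => cases v <;> cases w <;> simp [QFE.Eval, heq, eq_comm (a := b), eq_comm (a := d)]
  | not f hf => simp [QFE.Eval, hf]
  | and f g hf hg => simp [QFE.Eval, hf, hg]
  | or f g hf hg => simp [QFE.Eval, hf, hg]

open Classical in
/-- The pullback of `S` along `π`, except that distinct elements `a`, `b` with `π a = π b` are
related to each other as `π a` is to its partner `p (π a)`, oriented by `i`. -/
def Struc.blowup {U B D E : Type} (S : Struc U B D) (π : E → D) (p : D → D) (i : E → ℕ) :
    Struc U B E where
  unary P a := S.unary P (π a)
  binary R a b :=
    if π a = π b ∧ a ≠ b then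
      if i a < i b then S.binary R (π a) (p (π a)) else S.binary R (p (π a)) (π a)
    else S.binary R (π a) (π b)

namespace Struc

variable {U B D E : Type} (S : Struc U B D) (π : E → D) (p : D → D) (i : E → ℕ)

theorem oneType_blowup (a : E) : (S.blowup π p i).oneType a = S.oneType (π a) := by
  simp [oneType, blowup]

theorem eval_blowup {f : QFE U B} (hf : ∀ c d, f.Eval S c d) (hi : Function.Injective i)
    (hp : ∀ a b, a ≠ b → π a = π b → p (π a) ≠ π a ∧ S.oneType (p (π a)) = S.oneType (π a))
    (a b : E) : f.Eval (S.blowup π p i) a b := by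
  by_cases hab : a ≠ b ∧ π a = π b
  · obtain ⟨hne, hπ⟩ := hab
    obtain ⟨hpne, hpt⟩ := hp a b hne hπ
    rcases lt_or_gt_of_ne (hi.ne hne) with hlt | hlt
    · refine (QFE.eval_congr (c := π a) (d := p (π a)) (oneType_blowup ..) ?_ ?_ ?_ ?_ f).2
        (hf _ _)
      · rw [oneType_blowup, hpt, hπ]
      · simp [hne, hpne.symm]
      · simp [blowup, hne, hπ, hlt]
      · simp [blowup, hne.symm, hπ, hlt.not_gt]
    · refine (QFE.eval_congr (c := p (π a)) (d := π a) ?_ ?_ ?_ ?_ ?_ f).2 (hf _ _)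
      · rw [oneType_blowup, hpt]
      · rw [oneType_blowup, hπ]
      · simp [hne, hpne]
      · simp [blowup, hne, hπ, hlt.not_gt]
      · simp [blowup, hne.symm, hπ, hlt]
  · have hab' : π a = π b → a = b := fun h => by_contra fun hne => hab ⟨hne, h⟩
    refine (QFE.eval_congr (oneType_blowup ..) (oneType_blowup ..)
      ⟨congrArg π, hab'⟩ (fun R => ?_) (fun R => ?_) f).2 (hf _ _)
    · have : ¬ (π a = π b ∧ a ≠ b) := fun h => h.2 (hab' h.1)
      simp only [blowup, if_neg this]
    · have : ¬ (π b = π a ∧ b ≠ a) := fun h => h.2 (hab' h.1.symm).symm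
      simp only [blowup, if_neg this]

theorem exists_binary_blowup (hπ : Function.Surjective π) {R : B}
    (hR : ∀ c, ∃ d, S.binary R c d) (a : E) : ∃ b, (S.blowup π p i).binary R a b := by
  obtain ⟨d, hd⟩ := hR (π a)
  by_cases had : π a = d
  · exact ⟨a, by simpa [blowup, had] using hd⟩
  · obtain ⟨b, rfl⟩ := hπ d
    exact ⟨b, by simpa [blowup, had] using hd⟩

end Struc

theorem config_eq_card_oneType {U B D : Type} (S : Struc U B D) (τ : OneType U B) :
    config S τ = Nat.card {e // S.oneType e = τ} := by
  simp only [config, realizes1_iff_oneType_eq]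

/-- Monotonicity for SNF-with-equality sentences: if for every
1-type `τ`, `n' τ ≥ n τ` whenever `n τ > 1` and `n' τ = n τ` whenever `n τ ≤ 1`,
then satisfiability of `n` w.r.t. `Γ` implies satisfiability of `n'`. -/
theorem statement9 {U B : Type} [Fintype U] [Fintype B] (Γ : SNFE U B)
    (n n' : OneType U B → ℕ)
    (h : ∀ τ, (1 < n τ → n τ ≤ n' τ) ∧ (n τ ≤ 1 → n' τ = n τ))
    (hn : SatConfig Γ n) :
    SatConfig Γ n' := by
  classical
  obtain ⟨D, _, M, ⟨hphi, hbeta⟩, rfl⟩ := hn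
  have hle (τ) : config M τ ≤ n' τ := by
    rcases lt_or_ge 1 (config M τ) with hτ | hτ
    · exact (h τ).1 hτ
    · exact ((h τ).2 hτ).ge
  have hlt (τ) (k : Fin (n' τ - config M τ)) : 1 < config M τ := by
    by_contra hτ
    have := (h τ).2 (not_lt.1 hτ)
    have := k.2
    omega
  have hrep (x : Σ τ, Fin (n' τ - config M τ)) : ∃ e, M.oneType e = x.1 := by
    have hx := hlt x.1 x.2
    rw [config_eq_card_oneType] at hx
    obtain ⟨⟨e, he⟩⟩ := (Nat.card_pos_iff.1 (zero_lt_one.trans hx)).1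
    exact ⟨e, he⟩
  choose r hr using hrep
  have hpartner (e : D) : ∃ f, 1 < config M (M.oneType e) →
      f ≠ e ∧ M.oneType f = M.oneType e := by
    by_cases he : 1 < config M (M.oneType e)
    · rw [config_eq_card_oneType, Nat.card_eq_fintype_card] at he
      obtain ⟨⟨f, hf⟩, hne⟩ := Fintype.exists_ne_of_one_lt_card he ⟨e, rfl⟩
      exact ⟨f, fun _ => ⟨fun hfe => hne (Subtype.ext hfe), hf⟩⟩
    · exact ⟨e, fun h => absurd h he⟩
  choose p hp using hpartner
  let E := D ⊕ Σ τ, Fin (n' τ - config M τ)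
  let π : E → D := Sum.elim id r
  have : Fintype (OneType U B) := Fintype.ofFinite _
  let i : E → ℕ := fun a => Fintype.equivFin E a
  have hi : Function.Injective i := Fin.val_injective.comp (Fintype.equivFin E).injective
  refine ⟨E, inferInstance, M.blowup π p i, ⟨M.eval_blowup π p i hphi hi ?_, fun k =>
    M.exists_binary_blowup π p i (fun d => ⟨Sum.inl d, rfl⟩) (hbeta k)⟩, funext fun τ => ?_⟩
  · intro a b hne hab
    apply hp
    rcases a with a | x
    · rcases b with b | y
      · exact absurd (congrArg Sum.inl hab) hne
      · rw [hab]
        exact (hr y).symm ▸ hlt y.1 y.2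
    · exact (hr x).symm ▸ hlt x.1 x.2
  · rw [config_eq_card_oneType]
    simp only [Struc.oneType_blowup]
    rw [Nat.card_congr (Equiv.subtypeSum (p := fun a : E => M.oneType (π a) = τ)), Nat.card_sum]
    have hnew : Nat.card {x // M.oneType (r x) = τ} = n' τ - config M τ := by
      simp only [hr]
      rw [Nat.card_congr (Equiv.sigmaSubtype τ), Nat.card_fin]
    have hold := config_eq_card_oneType M τ
    have := hle τ
    change Nat.card {e // M.oneType e = τ} + Nat.card {x // M.oneType (r x) = τ} = n' τ
    omega
end

section
/- Let Γ be an SNF-with-equality sentence over L with m existentially quantified conjuncts, and set δ = max(m(m+1), 2m+1). For every configuration n and every 1-type τ with n(τ) > δ: if n is satisfiable with respect to Γ, then the configuration n[τ ↦ δ], which equals n at every 1-type except that its value at τ is δ, is satisfiable with respect to Γ. -/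
/-- A set `T` of more than `m (m + 1)` elements has an element `a` such that every `d` having `a`
among its `m` witnesses can use another `c ∈ T` in its place: `c` is not a witness of `d`, nor is
`d` a witness of `c`. -/
theorem exists_deletable {D : Type} [Fintype D] [DecidableEq D] {m : ℕ} (T : Finset D)
    (w : Fin m → D → D) (hT : m * (m + 1) < T.card) :
    ∃ a ∈ T, ∀ d k, w k d = a → ∃ c ∈ T, (∀ l, w l d ≠ c) ∧ ∀ l, w l c ≠ d := by
  classical
  let W : D → Finset D := fun d => Finset.univ.image fun k => w k d
  have hW : ∀ d, (W d).card ≤ m := fun d => by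
    simpa using Finset.card_image_le (s := (Finset.univ : Finset (Fin m))) (f := fun k => w k d)
  let bad : Finset D := Finset.univ.filter fun d => ∀ a ∈ T, a ∈ W d ∨ d ∈ W a
  have hcount : bad.card * (T.card - m) ≤ T.card * m := by
    refine Finset.card_mul_le_card_mul (fun d a => d ∈ W a) (fun d hd => ?_) (fun a _ => ?_)
    · have hd' : ∀ a ∈ T, a ∈ W d ∨ d ∈ W a := (Finset.mem_filter.mp hd).2
      have hsub : T \ W d ⊆ T.bipartiteAbove (fun d a => d ∈ W a) d := fun a ha => by
        rw [Finset.mem_sdiff] at ha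
        exact Finset.mem_filter.mpr ⟨ha.1, (hd' a ha.1).resolve_left ha.2⟩
      have h₁ := Finset.card_le_card hsub
      have h₂ := Finset.le_card_sdiff (W d) T
      have h₃ := hW d
      omega
    · refine (Finset.card_le_card fun d hd => ?_).trans (hW a)
      exact (Finset.mem_filter.mp hd).2
  have hbad : bad.card ≤ m := by
    by_contra! hlt
    obtain ⟨r, hr⟩ : ∃ r, T.card = m + r := Nat.exists_eq_add_of_le (by nlinarith [Nat.zero_le (m * m)])
    rw [hr] at hcount hT
    simp only [Nat.add_sub_cancel_left] at hcount
    nlinarith [Nat.mul_le_mul_right r hlt]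
  have hunion : (bad.biUnion W).card < T.card := by
    have h₁ : (bad.biUnion W).card ≤ bad.card * m :=
      Finset.card_biUnion_le_card_mul _ _ _ fun d _ => hW d
    nlinarith [Nat.mul_le_mul_right m hbad]
  obtain ⟨a, haT, ha⟩ := Finset.exists_mem_notMem_of_card_lt_card hunion
  refine ⟨a, haT, fun d k hk => ?_⟩
  have hd : d ∉ bad := fun hd => ha <| Finset.mem_biUnion.mpr
    ⟨d, hd, Finset.mem_image.mpr ⟨k, Finset.mem_univ _, hk⟩⟩
  simpa [bad, W] using hd

/-- On a set of at least `2 m + 1` elements there is a partial colouring of the ordered pairs with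
`m` colours that orients every coloured pair and gives every element an out-edge of each colour. -/
theorem exists_oriented_colouring {D : Type} {m : ℕ} (A : Finset D) (hA : 2 * m + 1 ≤ A.card) :
    ∃ s : D → D → Option (Fin m), (∀ x k, ∃ y ∈ A, s x y = some k) ∧
      ∀ x y k, s x y = some k → s y x = none := by
  classical
  obtain ⟨p, hp⟩ : ∃ p, A.card = p + 1 := ⟨A.card - 1, by omega⟩
  let e : A ≃ Fin (p + 1) := A.equivFinOfCardEq hp
  let ρ : D → Fin (p + 1) := fun x => if h : x ∈ A then e ⟨x, h⟩ else 0
  refine ⟨fun x y => if h : 0 < (ρ y - ρ x).val ∧ (ρ y - ρ x).val - 1 < m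
    then some ⟨(ρ y - ρ x).val - 1, h.2⟩ else none, fun x k => ?_, fun x y k h => ?_⟩
  · let j : Fin (p + 1) := ⟨k.val + 1, by omega⟩
    refine ⟨e.symm (ρ x + j), (e.symm (ρ x + j)).2, ?_⟩
    have hρ : ρ (e.symm (ρ x + j)) = ρ x + j := by simp [ρ]
    have hj : (ρ (e.symm (ρ x + j)) - ρ x).val = k.val + 1 := by
      rw [hρ, add_sub_cancel_left]
    have hk := k.isLt
    simp only [hj]
    rw [dif_pos (by omega)]
    simp
  · simp only at h ⊢
    split_ifs at h with hxy
    rw [dif_neg]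
    rintro ⟨h₁, h₂⟩
    have hx := (ρ x).isLt
    have hy := (ρ y).isLt
    rcases le_or_gt (ρ x) (ρ y) with hle | hlt
    · rcases hle.eq_or_lt with heq | hlt
      · simp [heq] at h₁
      · rw [Fin.sub_val_of_le hle] at hxy
        rw [Fin.coe_sub_iff_lt.mpr hlt] at h₂
        rw [Fin.lt_def] at hlt
        omega
    · rw [Fin.sub_val_of_le hlt.le] at h₂
      rw [Fin.coe_sub_iff_lt.mpr hlt] at hxy
      rw [Fin.lt_def] at hlt
      omega

/-- The 1-type realized by an element. -/
def Struc.tp {U B D : Type} (S : Struc U B D) (e : D) : OneType U B where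
  unary P := S.unary P e
  binary R := S.binary R e e

theorem realizes1_iff {U B D : Type} {S : Struc U B D} {e : D} {τ : OneType U B} :
    Realizes1 S e τ ↔ S.tp e = τ := by
  refine ⟨fun ⟨h₁, h₂⟩ => ?_, ?_⟩
  · cases τ
    simp only [Struc.tp, OneType.mk.injEq]
    exact ⟨funext fun P => propext (h₁ P), funext fun R => propext (h₂ R)⟩
  · rintro rfl
    exact ⟨fun _ => Iff.rfl, fun _ => Iff.rfl⟩

/-- The structure on `E` in which the pair `(x, y)` looks like the pair `(h x y, h y x)` of `S`. -/
def Struc.ofViews {U B D E : Type} (S : Struc U B D) (h : E → E → D) : Struc U B E where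
  unary P x := S.unary P (h x x)
  binary R x y := S.binary R (h x y) (h y x)

theorem QFE.eval_ofViews {U B D E : Type} {S : Struc U B D} {h : E → E → D}
    (htp : ∀ x y, S.tp (h x y) = S.tp (h x x)) (hne : ∀ x y, x ≠ y → h x y ≠ h y x)
    (x y : E) (φ : QFE U B) :
    φ.Eval (S.ofViews h) x y ↔ φ.Eval S (h x y) (h y x) := by
  have hu : ∀ P x y, S.unary P (h x x) ↔ S.unary P (h x y) := fun P x y =>
    iff_of_eq (congrFun (congrArg OneType.unary (htp x y)) P).symm
  have hb : ∀ R x y, S.binary R (h x x) (h x x) ↔ S.binary R (h x y) (h x y) := fun R x y =>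
    iff_of_eq (congrFun (congrArg OneType.binary (htp x y)) R).symm
  have heq : ∀ x y, x = y ↔ h x y = h y x := fun x y =>
    ⟨fun e => by rw [e], fun e => by_contra fun hxy => hne x y hxy e⟩
  induction φ with
  | uatom P v => cases v <;> simpa [QFE.Eval, Struc.ofViews] using hu P _ _
  | batom R v w =>
    cases v <;> cases w <;> simp [QFE.Eval, Struc.ofViews, hb R x y, hb R y x]
  | eq v w =>
    cases v <;> cases w <;> simp [QFE.Eval]
    · exact heq x y
    · exact heq y x
  | not f hf => simp [QFE.Eval, hf]
  | and f g hf hg => simp [QFE.Eval, hf, hg]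
  | or f g hf hg => simp [QFE.Eval, hf, hg]

theorem config_ofViews_ne {U B D : Type} [Fintype D] [DecidableEq (OneType U B)]
    {M : Struc U B D} (a : D) {h : {x // x ≠ a} → {x // x ≠ a} → D} (hself : ∀ x, h x x = x) :
    config (M.ofViews h) = Function.update (config M) (M.tp a) (config M (M.tp a) - 1) := by
  classical
  have htp : ∀ x, (M.ofViews h).tp x = M.tp x := fun x => by
    simp [Struc.tp, Struc.ofViews, hself]
  have hcard : ∀ σ, config (M.ofViews h) σ =
      ((Finset.univ.filter fun x => M.tp x = σ).erase a).card := fun σ => by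
    simp only [config, realizes1_iff, htp]
    rw [← Nat.card_eq_finsetCard]
    refine Nat.card_congr ?_
    exact (Equiv.subtypeSubtypeEquivSubtypeInter (fun x => x ≠ a) (fun x => M.tp x = σ)).trans
      (Equiv.subtypeEquivRight fun x => by simp)
  have hcard' : ∀ σ, config M σ = (Finset.univ.filter fun x => M.tp x = σ).card := fun σ => by
    simp only [config, realizes1_iff]
    rw [Nat.card_eq_fintype_card, Fintype.card_subtype]
  funext σ
  rw [hcard]
  by_cases hσ : σ = M.tp a
  · subst hσ
    rw [Function.update_self, hcard', Finset.card_erase_of_mem (by simp)]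
  · rw [Function.update_of_ne hσ, hcard', Finset.erase_eq_of_notMem (by simpa using Ne.symm hσ)]

open Classical in
theorem SatConfig.update_pred {U B : Type} {Γ : SNFE U B} {n : OneType U B → ℕ}
    (hn : SatConfig Γ n) {τ : OneType U B} (h₁ : Γ.m * (Γ.m + 1) < n τ)
    (h₂ : 2 * Γ.m + 1 < n τ) : SatConfig Γ (Function.update n τ (n τ - 1)) := by
  obtain ⟨D, _, M, ⟨hphi, hbeta⟩, rfl⟩ := hn
  choose w hw using hbeta
  let T : Finset D := Finset.univ.filter fun x => M.tp x = τ
  have hT : ∀ {x}, x ∈ T ↔ M.tp x = τ := by simp [T]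
  have hcard : config M τ = T.card := by
    simp only [config, realizes1_iff]
    rw [Nat.card_eq_fintype_card, Fintype.card_subtype]
  rw [hcard] at h₁ h₂
  obtain ⟨a, haT, ha⟩ := exists_deletable T w h₁
  have hc : ∀ d, ∃ c, (∃ k, w k d = a) → c ∈ T ∧ (∀ l, w l d ≠ c) ∧ ∀ l, w l c ≠ d := fun d => by
    by_cases hd : ∃ k, w k d = a
    · obtain ⟨k, hk⟩ := hd
      obtain ⟨c, hcT, hc⟩ := ha d k hk
      exact ⟨c, fun _ => ⟨hcT, hc⟩⟩
    · exact ⟨d, fun h => absurd h hd⟩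
  choose c hc using hc
  obtain ⟨s, hs, hs'⟩ := exists_oriented_colouring (m := Γ.m) (T.erase a)
    (by rw [Finset.card_erase_of_mem haT]; omega)
  let inner : D → D → D := fun x y => match s y x with
    | some k => if w k y ∈ T ∧ w k y ≠ y then w k y else x
    | none => x
  let h : D → D → D := fun x y =>
    if x = y ∨ x ∉ T then x
    else if y ∈ T then inner x y
    else if (∃ k, w k y = a) ∧ x = c y then a else x
  have hself : ∀ x, h x x = x := fun x => by simp [h]
  have hout : ∀ {x y}, x ∉ T → h x y = x := fun hx => by simp [h, hx]
  have hin : ∀ {x y}, x ∈ T → y ∈ T → x ≠ y → h x y = inner x y := fun hx hy hxy => by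
    simp [h, hx, hy, hxy]
  have hmix : ∀ {x y}, x ∈ T → y ∉ T →
      h x y = if (∃ k, w k y = a) ∧ x = c y then a else x := fun {x y} hx hy => by
    have hxy : x ≠ y := fun e => hy (e ▸ hx)
    simp [h, hx, hy, hxy]
  have hmem : ∀ {x y}, x ∈ T → h x y ∈ T := fun {x y} hx => by
    simp only [h, inner]
    split_ifs with _ _ _
    · exact hx
    · split
      · split_ifs with hk
        · exact hk.1
        · exact hx
      · exact hx
    · exact haT
    · exact hx
  have htp : ∀ x y, M.tp (h x y) = M.tp x := fun x y => by
    by_cases hx : x ∈ T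
    · rw [hT.mp hx, hT.mp (hmem hx)]
    · rw [hout hx]
  have hinner : ∀ x y k, s y x = some k → inner y x = y ∧
      inner x y = if w k y ∈ T ∧ w k y ≠ y then w k y else x := fun x y k hk => by
    simp [inner, hk, hs' _ _ _ hk]
  have hne : ∀ x y, x ≠ y → h x y ≠ h y x := fun x y hxy => by
    by_cases hx : x ∈ T <;> by_cases hy : y ∈ T
    · rw [hin hx hy hxy, hin hy hx hxy.symm]
      rcases hyx : s y x with _ | k
      · rcases hxy' : s x y with _ | k
        · simpa [inner, hyx, hxy'] using hxy
        · rw [(hinner _ _ _ hxy').1, (hinner _ _ _ hxy').2]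
          split_ifs with hk
          · exact hk.2.symm
          · exact hxy
      · rw [(hinner _ _ _ hyx).1, (hinner _ _ _ hyx).2]
        split_ifs with hk
        · exact hk.2
        · exact hxy
    · rw [hout hy]
      exact fun e => hy (e ▸ hmem hx)
    · rw [hout hx]
      exact fun e => hx (e ▸ hmem hy)
    · rwa [hout hx, hout hy]
  have hwit : ∀ k x, x ≠ a → ∃ y, y ≠ a ∧ h x y = x ∧ h y x = w k x := fun k x hxa => by
    by_cases hwx : w k x = x
    · exact ⟨x, hxa, hself x, by rw [hself, hwx]⟩
    by_cases hx : x ∈ T <;> by_cases hy : w k x ∈ T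
    · obtain ⟨y, hyT, hy'⟩ := hs x k
      obtain ⟨hya, hyT⟩ := Finset.mem_erase.mp hyT
      have hxy : x ≠ y := by
        rintro rfl
        simp [hs' _ _ _ hy'] at hy'
      refine ⟨y, hya, ?_, ?_⟩
      · rw [hin hx hyT hxy, (hinner _ _ _ hy').1]
      · rw [hin hyT hx hxy.symm, (hinner _ _ _ hy').2, if_pos ⟨hy, hwx⟩]
    · refine ⟨w k x, fun e => hy (e ▸ haT), ?_, hout hy⟩
      rw [hmix hx hy, if_neg]
      rintro ⟨hk, e⟩
      exact (hc _ hk).2.2 k (by rw [← e])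
    · by_cases hya : w k x = a
      · have hk : ∃ k, w k x = a := ⟨k, hya⟩
        obtain ⟨hcT, hcd, -⟩ := hc x hk
        refine ⟨c x, fun e => hcd k (hya.trans e.symm), hout hx, ?_⟩
        rw [hmix hcT hx, if_pos ⟨hk, rfl⟩, hya]
      · refine ⟨w k x, hya, hout hx, ?_⟩
        rw [hmix hy hx, if_neg]
        rintro ⟨hk, e⟩
        exact (hc x hk).2.1 k e
    · exact ⟨w k x, fun e => hy (e ▸ haT), hout hx, hout hy⟩
  let h' : {x // x ≠ a} → {x // x ≠ a} → D := fun x y => h x y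
  refine ⟨{x // x ≠ a}, inferInstance, M.ofViews h', ⟨fun x y => ?_, fun k x => ?_⟩, ?_⟩
  · exact (QFE.eval_ofViews (h := h') (fun x y => (htp x y).trans (htp x x).symm)
      (fun x y hxy => hne x y fun e => hxy (Subtype.ext e)) x y Γ.phi).mpr (hphi _ _)
  · obtain ⟨y, hya, hxy, hyx⟩ := hwit k x x.2
    refine ⟨⟨y, hya⟩, ?_⟩
    change M.binary _ (h x y) (h y x)
    rw [hxy, hyx]
    exact hw k x
  · rw [config_ofViews_ne a fun x => hself x, hT.mp haT]

open Classical in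
theorem SatConfig.update_of_le {U B : Type} {Γ : SNFE U B} {τ : OneType U B} {δ : ℕ}
    (h₁ : Γ.m * (Γ.m + 1) ≤ δ) (h₂ : 2 * Γ.m + 1 ≤ δ) (r : ℕ) {n : OneType U B → ℕ}
    (hn : SatConfig Γ n) (hr : n τ = δ + r) : SatConfig Γ (Function.update n τ δ) := by
  induction r generalizing n with
  | zero =>
    rw [Nat.add_zero] at hr
    rwa [← hr, Function.update_eq_self]
  | succ r ih =>
    have := ih (hn.update_pred (τ := τ) (by omega) (by omega))
      (by rw [Function.update_self]; omega)
    rwa [Function.update_idem] at this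

/- **Statement 10.** With `δ = max (m(m+1)) (2m+1)`, if `n τ > δ` and `n` is
satisfiable w.r.t. an SNF-with-equality sentence `Γ`, then `n[τ ↦ δ]` is
satisfiable. -/
open Classical in
theorem statement10 {U B : Type} [Fintype U] [Fintype B] (Γ : SNFE U B)
    (n : OneType U B → ℕ) (τ : OneType U B)
    (hτ : max (Γ.m * (Γ.m + 1)) (2 * Γ.m + 1) < n τ)
    (hn : SatConfig Γ n) :
    SatConfig Γ (fun σ => if σ = τ then max (Γ.m * (Γ.m + 1)) (2 * Γ.m + 1) else n σ) := by
  obtain ⟨r, hr⟩ := Nat.exists_eq_add_of_le hτ.le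
  convert hn.update_of_le (le_max_left _ _) (le_max_right _ _) r hr using 1
  funext σ
  rw [Function.update_apply]
end
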